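/- In the real numbers, 2·ζ(2,1,1) = ζ(4) + ζ(2,2) + ζ(3,1), where ζ(k_1,…,k_r) = Σ_{m_1 > m_2 > ⋯ > m_r > 0} 1/(m_1^{k_1}⋯m_r^{k_r}). -/

import Mathlib

/-- The single zeta value `ζ(k) = ∑_{m>0} 1/m^k`. -/
noncomputable def zeta1 (k : ℕ) : ℝ :=
  ∑' m : {m : ℕ // 0 < m}, 1 / ((m : ℕ) : ℝ) ^ k

/-- The double zeta value `ζ(k₁,k₂) = ∑_{m₁>m₂>0} 1/(m₁^{k₁} m₂^{k₂})`. -/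
noncomputable def zeta2 (k₁ k₂ : ℕ) : ℝ :=
  ∑' p : {p : ℕ × ℕ // p.2 < p.1 ∧ 0 < p.2},
    1 / (((p : ℕ × ℕ).1 : ℝ) ^ k₁ * ((p : ℕ × ℕ).2 : ℝ) ^ k₂)

/-- The triple zeta value `ζ(k₁,k₂,k₃) = ∑_{m₁>m₂>m₃>0} 1/(m₁^{k₁} m₂^{k₂} m₃^{k₃})`. -/
noncomputable def zeta3 (k₁ k₂ k₃ : ℕ) : ℝ :=
  ∑' p : {p : ℕ × ℕ × ℕ // p.2.1 < p.1 ∧ p.2.2 < p.2.1 ∧ 0 < p.2.2},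
    1 / (((p : ℕ × ℕ × ℕ).1 : ℝ) ^ k₁ * ((p : ℕ × ℕ × ℕ).2.1 : ℝ) ^ k₂ *
      ((p : ℕ × ℕ × ℕ).2.2 : ℝ) ^ k₃)

open ENNReal in
lemma mzv_tele (F : ℕ → ℝ) (hF : Antitone F) (h0 : Filter.Tendsto F Filter.atTop (nhds 0)) :
    ∑' a, ENNReal.ofReal (F a - F (a + 1)) = ENNReal.ofReal (F 0) := by
  have hs : HasSum (fun a => F a - F (a + 1)) (F 0) := by
    rw [hasSum_iff_tendsto_nat_of_nonneg (fun i => sub_nonneg.2 (hF (Nat.le_succ i)))]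
    simp only [Finset.sum_range_sub']
    simpa using h0.const_sub (F 0)
  rw [← hs.tsum_eq, ENNReal.ofReal_tsum_of_nonneg (fun i => sub_nonneg.2 (hF (Nat.le_succ i)))
    hs.summable]

/-- The connector `m! n! / (m+n)!`. -/
noncomputable def mzvC (m n : ℕ) : ℝ := (m.factorial * n.factorial : ℝ) / ((m + n).factorial : ℝ)

lemma mzvC_nonneg (m n : ℕ) : 0 ≤ mzvC m n := by unfold mzvC; positivity

lemma mzvC_comm (m n : ℕ) : mzvC m n = mzvC n m := by
  unfold mzvC; rw [add_comm m n, mul_comm]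

lemma mzvC_zero (m : ℕ) : mzvC m 0 = 1 := by
  unfold mzvC
  have : (m.factorial : ℝ) ≠ 0 := by positivity
  simp [this]

lemma mzvC_succ (m n : ℕ) : mzvC m (n + 1) * (m + n + 1) = mzvC m n * (n + 1) := by
  unfold mzvC
  rw [← add_assoc, Nat.factorial_succ, Nat.factorial_succ]
  have h : ((m + n).factorial : ℝ) ≠ 0 := by positivity
  have h2 : (m + n + 1 : ℝ) ≠ 0 := by positivity
  push_cast
  field_simp

lemma mzvC_anti (m n : ℕ) : mzvC m (n + 1) ≤ mzvC m n := by
  have h := mzvC_succ m n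
  have h1 := mzvC_nonneg m (n + 1)
  have h2 : (0 : ℝ) ≤ m := by positivity
  have h3 : (0 : ℝ) < n + 1 := by positivity
  nlinarith [mul_nonneg h1 h2]

lemma mzvC_le (m n : ℕ) : mzvC (m + 1) n ≤ 1 / ((n : ℝ) + 1) := by
  induction m with
  | zero =>
    have h := mzvC_succ n 0
    rw [mzvC_zero] at h
    rw [mzvC_comm, le_div_iff₀ (by positivity)]
    norm_num at h ⊢
    exact h.le
  | succ k ih =>
    refine le_trans ?_ ih
    rw [mzvC_comm, mzvC_comm (k + 1)]
    exact mzvC_anti n (k + 1)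

lemma mzvC_tendsto (m : ℕ) : Filter.Tendsto (mzvC (m + 1)) Filter.atTop (nhds 0) :=
  squeeze_zero (fun n => mzvC_nonneg _ n) (fun n => mzvC_le m n)
    tendsto_one_div_add_atTop_nhds_zero_nat

/-- Transport relation, with a nonnegative scalar. -/
lemma mzv_transport (c : ℝ) (hc : 0 ≤ c) (m n : ℕ) :
    ENNReal.ofReal (c * (1 / ((m : ℝ) + 1)) * mzvC (m + 1) n) =
      ∑' a : ℕ, ENNReal.ofReal (c * (1 / ((n : ℝ) + a + 1)) * mzvC (m + 1) (n + a + 1)) := by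
  have hd : 0 ≤ c * (1 / ((m : ℝ) + 1)) := by positivity
  have := mzv_tele (fun a => c * (1 / ((m : ℝ) + 1)) * mzvC (m + 1) (n + a))
    (antitone_nat_of_succ_le fun a => mul_le_mul_of_nonneg_left (mzvC_anti _ _) hd)
    (by
      have h := ((mzvC_tendsto m).comp (Filter.tendsto_add_atTop_nat n)).const_mul
        (c * (1 / ((m : ℝ) + 1)))
      simpa [Function.comp_def, add_comm] using h)
  rw [show n = n + 0 from rfl, ← this]
  refine tsum_congr fun a => ?_
  congr 1
  have h := mzvC_succ (m + 1) (n + a)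
  push_cast at h
  have h1 : mzvC (m + 1) (n + a) =
      mzvC (m + 1) (n + a + 1) * (m + 1 + (n + a) + 1) / (n + a + 1) := by
    rw [eq_div_iff (by positivity), ← h]
  rw [← add_assoc, h1]
  simp only [add_zero]
  field_simp
  ring

noncomputable def mzvZ (k : ℕ) : ENNReal := ∑' a : ℕ, ENNReal.ofReal (1 / ((a : ℝ) + 1) ^ k)

noncomputable def mzvZZ (k l : ℕ) : ENNReal :=
  ∑' a : ℕ, ∑' b : ℕ, ENNReal.ofReal (1 / (((a : ℝ) + b + 2) ^ k * ((a : ℝ) + 1) ^ l))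

noncomputable def mzvZZZ : ENNReal :=
  ∑' a : ℕ, ∑' b : ℕ, ∑' c : ℕ, ENNReal.ofReal (1 / (((a : ℝ) + b + c + 3) ^ 2 *
    ((a : ℝ) + b + 2) ^ 1 * ((a : ℝ) + 1) ^ 1))

lemma zeta1_eq (k : ℕ) : zeta1 k = (mzvZ k).toReal := by
  unfold zeta1 mzvZ
  rw [ENNReal.tsum_toReal_eq (fun _ => ENNReal.ofReal_ne_top)]
  let e : ℕ ≃ {m : ℕ // 0 < m} :=
    { toFun := fun a => ⟨a + 1, a.succ_pos⟩
      invFun := fun m => m.1 - 1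
      left_inv := fun a => by simp
      right_inv := fun m => by
        obtain ⟨m, hm⟩ := m
        ext; simp; omega }
  rw [← e.tsum_eq]
  refine tsum_congr fun a => ?_
  rw [ENNReal.toReal_ofReal (by positivity)]
  simp [e]

lemma zeta2_eq (k l : ℕ) : zeta2 k l = (mzvZZ k l).toReal := by
  unfold zeta2 mzvZZ
  rw [← ENNReal.tsum_prod, ENNReal.tsum_toReal_eq (fun _ => ENNReal.ofReal_ne_top)]
  let e : ℕ × ℕ ≃ {p : ℕ × ℕ // p.2 < p.1 ∧ 0 < p.2} :=
    { toFun := fun a => ⟨(a.1 + a.2 + 2, a.1 + 1), by constructor <;> simp <;> omega⟩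
      invFun := fun m => (m.1.2 - 1, m.1.1 - m.1.2 - 1)
      left_inv := fun a => by ext <;> simp <;> omega
      right_inv := fun m => by
        obtain ⟨⟨m, n⟩, hm⟩ := m
        simp only at hm
        ext <;> simp <;> omega }
  rw [← e.tsum_eq]
  refine tsum_congr fun a => ?_
  rw [ENNReal.toReal_ofReal (by positivity)]
  simp [e]

lemma zeta3_eq : zeta3 2 1 1 = mzvZZZ.toReal := by
  unfold zeta3 mzvZZZ
  simp_rw [← ENNReal.tsum_prod]
  rw [ENNReal.tsum_toReal_eq (fun _ => ENNReal.ofReal_ne_top)]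
  let e : ℕ × ℕ × ℕ ≃ {p : ℕ × ℕ × ℕ // p.2.1 < p.1 ∧ p.2.2 < p.2.1 ∧ 0 < p.2.2} :=
    { toFun := fun a => ⟨(a.1 + a.2.1 + a.2.2 + 3, a.1 + a.2.1 + 2, a.1 + 1), by constructor <;> simp <;> omega⟩
      invFun := fun m => (m.1.2.2 - 1, m.1.2.1 - m.1.2.2 - 1, m.1.1 - m.1.2.1 - 1)
      left_inv := fun a => by ext <;> simp <;> omega
      right_inv := fun m => by
        obtain ⟨⟨m, n, r⟩, hm⟩ := m
        simp only at hm
        ext <;> simp <;> omega }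
  rw [← e.tsum_eq]
  refine tsum_congr fun a => ?_
  rw [ENNReal.toReal_ofReal (by positivity)]
  simp [e]

/-- `ζ(4) = ζ(2,1,1)`. -/
lemma mzv_dual : mzvZ 4 = mzvZZZ := by
  have h1 : ∀ m : ℕ, ENNReal.ofReal (1 / ((m : ℝ) + 1) ^ 4) =
      ∑' a : ℕ, ∑' b : ℕ, ∑' c : ℕ, ENNReal.ofReal
        (1 / (((a : ℝ) + b + c + 3) * ((a : ℝ) + b + 2) * ((a : ℝ) + 1)) * (1 / ((m : ℝ) + 1))
          * mzvC (m + 1) (a + b + c + 3)) := by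
    intro m
    have e1 : 1 / ((m : ℝ) + 1) ^ 4 =
        1 / ((m : ℝ) + 1) ^ 3 * (1 / ((m : ℝ) + 1)) * mzvC (m + 1) 0 := by
      rw [mzvC_zero]; field_simp
    rw [e1, mzv_transport _ (by positivity)]
    refine tsum_congr fun a => ?_
    have e2 : 1 / ((m : ℝ) + 1) ^ 3 * (1 / (((0 : ℕ) : ℝ) + a + 1)) * mzvC (m + 1) (0 + a + 1) =
        1 / (((m : ℝ) + 1) ^ 2 * ((a : ℝ) + 1)) * (1 / ((m : ℝ) + 1)) * mzvC (m + 1) (a + 1) := by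
      rw [zero_add, Nat.cast_zero, zero_add]; field_simp
    rw [e2, mzv_transport _ (by positivity)]
    refine tsum_congr fun b => ?_
    have e3 : 1 / (((m : ℝ) + 1) ^ 2 * ((a : ℝ) + 1)) * (1 / (((a + 1 : ℕ) : ℝ) + b + 1)) *
          mzvC (m + 1) (a + 1 + b + 1) =
        1 / (((m : ℝ) + 1) * ((a : ℝ) + b + 2) * ((a : ℝ) + 1)) * (1 / ((m : ℝ) + 1)) *
          mzvC (m + 1) (a + b + 2) := by
      rw [show a + 1 + b + 1 = a + b + 2 by ring,
        show (((a + 1 : ℕ) : ℝ) + b + 1) = (a : ℝ) + b + 2 by push_cast; ring]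
      field_simp
    rw [e3, mzv_transport _ (by positivity)]
    refine tsum_congr fun c => ?_
    congr 1
    rw [show a + b + 2 + c + 1 = a + b + c + 3 by ring,
        show (((a + b + 2 : ℕ) : ℝ) + c + 1) = (a : ℝ) + b + c + 3 by push_cast; ring]
    field_simp
  unfold mzvZ mzvZZZ
  simp_rw [h1]
  rw [ENNReal.tsum_comm]
  refine tsum_congr fun a => ?_
  rw [ENNReal.tsum_comm]
  refine tsum_congr fun b => ?_
  rw [ENNReal.tsum_comm]
  refine tsum_congr fun c => ?_
  have e4 : 1 / (((a : ℝ) + b + c + 3) ^ 2 * ((a : ℝ) + b + 2) ^ 1 * ((a : ℝ) + 1) ^ 1) =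
      1 / (((a : ℝ) + b + c + 3) * ((a : ℝ) + b + 2) * ((a : ℝ) + 1)) *
        (1 / (((a + b + c + 2 : ℕ) : ℝ) + 1)) * mzvC (a + b + c + 2 + 1) 0 := by
    rw [mzvC_zero]; push_cast
    rw [show (a : ℝ) + b + c + 2 + 1 = a + b + c + 3 by ring]
    field_simp
  rw [e4, mzv_transport _ (by positivity)]
  refine tsum_congr fun m => ?_
  rw [mzvC_comm]
  simp

lemma mzv_harm (m : ℕ) : ∑' n : ℕ, ENNReal.ofReal (1 / ((n : ℝ) + 1) - 1 / ((n : ℝ) + m + 1)) =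
    ENNReal.ofReal (∑ j ∈ Finset.range m, 1 / ((j : ℝ) + 1)) := by
  have key := mzv_tele (fun n => ∑ j ∈ Finset.range m, 1 / ((n : ℝ) + j + 1)) ?_ ?_
  · simp only [Nat.cast_zero, zero_add] at key
    rw [← key]
    refine tsum_congr fun n => ?_
    congr 1
    rw [← Finset.sum_sub_distrib]
    have := Finset.sum_range_sub' (fun j : ℕ => 1 / ((n : ℝ) + j + 1)) m
    simp only [Nat.cast_zero, add_zero] at this
    rw [← this]
    refine Finset.sum_congr rfl fun j _ => ?_
    push_cast
    ring
  · refine antitone_nat_of_succ_le fun n => Finset.sum_le_sum fun j _ => ?_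
    apply one_div_le_one_div_of_le (by positivity)
    push_cast; linarith
  · rw [show (0 : ℝ) = ∑ j ∈ Finset.range m, (0 : ℝ) by simp]
    refine tendsto_finsetSum _ fun j _ => ?_
    have h := tendsto_one_div_add_atTop_nhds_zero_nat (𝕜 := ℝ).comp
      (Filter.tendsto_add_atTop_nat j)
    simpa [Function.comp_def] using h

lemma mzv_sum : mzvZ 4 + mzvZZ 3 1 = mzvZZ 2 2 + (mzvZZ 3 1 + mzvZZ 3 1) := by
  have hL : mzvZ 4 + mzvZZ 3 1 =
      ∑' a : ℕ, ∑' b : ℕ, ENNReal.ofReal (1 / (((a : ℝ) + b + 1) ^ 3 * ((a : ℝ) + 1))) := by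
    unfold mzvZ mzvZZ
    rw [← ENNReal.tsum_add]
    refine tsum_congr fun a => ?_
    rw [tsum_eq_zero_add' (f := fun b : ℕ =>
      ENNReal.ofReal (1 / (((a : ℝ) + b + 1) ^ 3 * ((a : ℝ) + 1)))) ENNReal.summable]
    congr 1
    · congr 1
      simp only [Nat.cast_zero, add_zero]
      field_simp
    · refine tsum_congr fun b => ?_
      push_cast
      rw [show (a : ℝ) + (b + 1) + 1 = a + b + 2 by ring, pow_one]
  have hM : ∑' a : ℕ, ∑' b : ℕ, ENNReal.ofReal (1 / (((a : ℝ) + b + 1) ^ 3 * ((a : ℝ) + 1))) =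
      ∑' s : ℕ, ∑' n : ℕ, ENNReal.ofReal
        (1 / (((s : ℝ) + 1) ^ 2 * ((n : ℝ) + 1) * ((s : ℝ) + n + 2))) := by
    rw [← ENNReal.tsum_prod (f := fun a b : ℕ =>
      ENNReal.ofReal (1 / (((a : ℝ) + b + 1) ^ 3 * ((a : ℝ) + 1)))),
      ← (Finset.HasAntidiagonal.sigmaAntidiagonalEquivProd (A := ℕ)).tsum_eq, ENNReal.tsum_sigma']
    refine tsum_congr fun s => ?_
    rw [tsum_fintype]
    have h2 : ∑' n : ℕ, ENNReal.ofReal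
        (1 / (((s : ℝ) + 1) ^ 2 * ((n : ℝ) + 1) * ((s : ℝ) + n + 2))) =
        ENNReal.ofReal (1 / ((s : ℝ) + 1) ^ 3) * ENNReal.ofReal
          (∑ j ∈ Finset.range (s + 1), 1 / ((j : ℝ) + 1)) := by
      rw [← mzv_harm, ← ENNReal.tsum_mul_left]
      refine tsum_congr fun n => ?_
      rw [← ENNReal.ofReal_mul (by positivity)]
      congr 1
      push_cast
      rw [show (n : ℝ) + (s + 1) + 1 = s + n + 2 by ring]
      field_simp
      ring
    rw [h2, ← ENNReal.ofReal_mul (by positivity), Finset.mul_sum,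
      ENNReal.ofReal_sum_of_nonneg (fun i _ => by positivity),
      ← Finset.Nat.sum_antidiagonal_eq_sum_range_succ_mk (n := s)
        (f := fun p : ℕ × ℕ => ENNReal.ofReal (1 / ((s : ℝ) + 1) ^ 3 * (1 / ((p.1 : ℝ) + 1))))]
    rw [← Finset.sum_coe_sort (Finset.HasAntidiagonal.antidiagonal s)]
    refine Finset.sum_congr rfl fun p _ => ?_
    obtain ⟨⟨a, b⟩, hp⟩ := p
    have hs : a + b = s := Finset.HasAntidiagonal.mem_antidiagonal.1 hp
    subst hs
    simp only [Finset.HasAntidiagonal.sigmaAntidiagonalEquivProd_apply]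
    congr 1
    push_cast
    field_simp
  have hT : mzvZZ 3 1 + mzvZZ 3 1 = ∑' s : ℕ, ∑' n : ℕ, ENNReal.ofReal
        (1 / (((s : ℝ) + 1) * ((n : ℝ) + 1) * ((s : ℝ) + n + 2) ^ 2)) := by
    have hsw : mzvZZ 3 1 = ∑' s : ℕ, ∑' n : ℕ, ENNReal.ofReal
        (1 / (((n : ℝ) + s + 2) ^ 3 * ((n : ℝ) + 1) ^ 1)) := by
      unfold mzvZZ; rw [ENNReal.tsum_comm]
    nth_rewrite 2 [hsw]
    unfold mzvZZ
    rw [← ENNReal.tsum_add]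
    refine tsum_congr fun s => ?_
    rw [← ENNReal.tsum_add]
    refine tsum_congr fun n => ?_
    rw [← ENNReal.ofReal_add (by positivity) (by positivity)]
    congr 1
    rw [show (n : ℝ) + s + 2 = s + n + 2 by ring]
    field_simp
    ring
  rw [hL, hM, hT]
  unfold mzvZZ
  rw [← ENNReal.tsum_add]
  refine tsum_congr fun s => ?_
  rw [← ENNReal.tsum_add]
  refine tsum_congr fun n => ?_
  rw [← ENNReal.ofReal_add (by positivity) (by positivity)]
  congr 1
  field_simp
  ring

lemma mzvZ_ne_top (k : ℕ) (hk : 2 ≤ k) : mzvZ k ≠ ⊤ := by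
  have h : Summable (fun a : ℕ => 1 / ((a : ℝ) + 1) ^ k) := by
    have := (summable_nat_add_iff 1).2 (Real.summable_one_div_nat_pow.2 (show 1 < k by omega))
    simpa using this
  exact h.tsum_ofReal_ne_top

lemma mzvZZ31_ne_top : mzvZZ 3 1 ≠ ⊤ := by
  refine ne_top_of_le_ne_top (ENNReal.mul_ne_top (mzvZ_ne_top 2 le_rfl) (mzvZ_ne_top 2 le_rfl)) ?_
  unfold mzvZZ mzvZ
  rw [← ENNReal.tsum_mul_right]
  refine ENNReal.tsum_le_tsum fun a => ?_
  rw [← ENNReal.tsum_mul_left]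
  refine ENNReal.tsum_le_tsum fun b => ?_
  rw [← ENNReal.ofReal_mul (by positivity)]
  apply ENNReal.ofReal_le_ofReal
  rw [one_div_mul_one_div]
  apply one_div_le_one_div_of_le (by positivity)
  have ha : (0 : ℝ) ≤ a := by positivity
  have hb : (0 : ℝ) ≤ b := by positivity
  have h1 : ((b : ℝ) + 1) ^ 2 ≤ (a + b + 2) ^ 2 := by gcongr; linarith; norm_num
  have h2 : (a : ℝ) + 1 ≤ a + b + 2 := by linarith
  calc ((a : ℝ) + 1) ^ 2 * ((b : ℝ) + 1) ^ 2 = ((b : ℝ) + 1) ^ 2 * ((a : ℝ) + 1) * ((a : ℝ) + 1) := by ring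
    _ ≤ ((a : ℝ) + b + 2) ^ 2 * ((a : ℝ) + b + 2) * ((a : ℝ) + 1) := by gcongr
    _ = _ := by ring

/-- **A relation among multiple zeta values:**
`2·ζ(2,1,1) = ζ(4) + ζ(2,2) + ζ(3,1)`. -/
theorem two_zeta_2_1_1 :
    2 * zeta3 2 1 1 = zeta1 4 + zeta2 2 2 + zeta2 3 1 := by
  have h := mzv_sum
  have h4 := mzvZ_ne_top 4 (by norm_num)
  have h31 := mzvZZ31_ne_top
  have h22 : mzvZZ 2 2 ≠ ⊤ := by
    refine ne_top_of_le_ne_top (ENNReal.add_ne_top.2 ⟨h4, h31⟩) ?_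
    rw [h]
    exact le_self_add
  have h' := congrArg ENNReal.toReal h
  rw [ENNReal.toReal_add h4 h31, ENNReal.toReal_add h22 (ENNReal.add_ne_top.2 ⟨h31, h31⟩),
    ENNReal.toReal_add h31 h31] at h'
  rw [zeta3_eq, zeta1_eq, zeta2_eq, zeta2_eq, ← mzv_dual]
  linarith
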